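/- Assume f is continuous, (x^k, d^k, α_k) is an Algorithm-2.1 sequence, and there exists ρ > 0 such that f(x^k) − f_target ≥ ρ for all k ∈ ℕ. Then lim_{k→∞} α_k = 0. -/

import Mathlib

open Filter Topology

/-- If a sequence bounded below decreases by `b k` at each step, up to a summable error `η k`,
then `b` is summable. -/
theorem summable_of_le_add_sub {a b η : ℕ → ℝ} {c : ℝ} (hη : ∀ k, 0 ≤ η k) (hηs : Summable η)
    (hb : ∀ k, 0 ≤ b k) (hc : ∀ k, c ≤ a k) (h : ∀ k, a (k + 1) ≤ a k + η k - b k) :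
    Summable b := by
  have key : ∀ n, a n + ∑ i ∈ Finset.range n, b i ≤ a 0 + ∑ i ∈ Finset.range n, η i := by
    intro n
    induction n with
    | zero => simp
    | succ n ih =>
      rw [Finset.sum_range_succ, Finset.sum_range_succ]
      linarith [h n]
  refine summable_of_sum_range_le (c := a 0 + ∑' i, η i - c) hb fun n => ?_
  linarith [key n, hc n, hηs.sum_le_tsum (Finset.range n) fun i _ => hη i]

/-- If an Algorithm-2.1 sequence has `f(xᵏ) − f_target` bounded away from zero,
then `αₖ → 0`. -/
theorem alg21_alpha_tendsto_zero
    (n : ℕ) (Ω : Set (EuclideanSpace ℝ (Fin n))) (hΩc : IsClosed Ω) (hΩconv : Convex ℝ Ω)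
    (f : EuclideanSpace ℝ (Fin n) → ℝ) (hf : Continuous f)
    (ftarget Δ γ : ℝ) (hΔ : 0 < Δ) (hγ : γ ∈ Set.Ioo (0 : ℝ) 1)
    (η : ℕ → ℝ) (hηpos : ∀ k, 0 < η k) (hηsum : Summable η)
    (x d : ℕ → EuclideanSpace ℝ (Fin n)) (α : ℕ → ℝ)
    (hxΩ : ∀ k, x k ∈ Ω)
    (hd : ∀ k, ‖d k‖ ≤ Δ) (hdΩ : ∀ k, x k + d k ∈ Ω)
    (hα : ∀ k, α k ∈ Set.Ioc (0 : ℝ) 1)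
    (hdec : ∀ k, f (x k + α k • d k) ≤
      f (x k) + η k - γ * (α k) ^ 2 * (f (x k) - ftarget))
    (hrej : ∀ k, α k = 1 ∨
      f (x k + (2 * α k) • d k) >
        f (x k) + η k - γ * (2 * α k) ^ 2 * (f (x k) - ftarget))
    (hmono : ∀ k, f (x (k + 1)) ≤ f (x k + α k • d k))
    (hbdd : ∃ ρ > 0, ∀ k, ρ ≤ f (x k) - ftarget) :
    Tendsto α atTop (𝓝 0) := by
  obtain ⟨ρ, hρ, hbdd⟩ := hbdd
  have hγρ : 0 < γ * ρ := mul_pos hγ.1 hρ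
  have hsum : Summable fun k => γ * ρ * α k ^ 2 := by
    refine summable_of_le_add_sub (a := fun k => f (x k)) (c := ftarget + ρ)
      (fun k => (hηpos k).le) hηsum (fun k => by positivity)
      (fun k => by linarith [hbdd k]) fun k => ?_
    have h := mul_le_mul_of_nonneg_left (hbdd k) (mul_nonneg hγ.1.le (sq_nonneg (α k)))
    linarith [hmono k, hdec k]
  have hsq : Tendsto (fun k => α k ^ 2) atTop (𝓝 0) :=
    ((summable_mul_left_iff hγρ.ne').mp hsum).tendsto_atTop_zero
  simpa [Real.sqrt_sq (hα _).1.le] using hsq.sqrt
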